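/- The matrix K̂ = I − (q − q⁻¹)·MD satisfies the homogeneous reflection-equation relation R K̂₁ R K̂₁ = K̂₁ R K̂₁ R in Mat_{N²}(A), where K̂₁ = K̂ ⊗ I. -/

import Mathlib

open scoped BigOperators

noncomputable section

/-- One-site embedding of an `N×N` matrix into `Mat_{N^k}` at 0-based position `i`
(the paper's `X_{i+1}` in 1-based numbering).  Out of range we return the identity. -/
def matAt {α : Type*} [Semiring α] (N k : ℕ) (X : Matrix (Fin N) (Fin N) α) (i : ℕ) :
    Matrix (Fin k → Fin N) (Fin k → Fin N) α :=
  if h : i < k then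
    Matrix.of fun a b =>
      if ∀ l : Fin k, (l : ℕ) ≠ i → a l = b l then X (a ⟨i, h⟩) (b ⟨i, h⟩) else 0
  else 1

/-- Two-site embedding of an operator on `V⊗V` into `Mat_{N^k}` at 0-based positions
`i, i+1` (the paper's `R_{i+1}` in 1-based numbering). -/
def opAt {α : Type*} [Semiring α] (N k : ℕ)
    (R : Matrix (Fin N × Fin N) (Fin N × Fin N) α) (i : ℕ) :
    Matrix (Fin k → Fin N) (Fin k → Fin N) α :=
  if h : i + 1 < k then
    Matrix.of fun a b =>
      if ∀ l : Fin k, (l : ℕ) ≠ i → (l : ℕ) ≠ i + 1 → a l = b l then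
        R (a ⟨i, by omega⟩, a ⟨i + 1, h⟩) (b ⟨i, by omega⟩, b ⟨i + 1, h⟩)
      else 0
  else 1

/-- A numeric (complex) matrix viewed inside `Mat(A)` via the unit of `A`. -/
def toA (A : Type*) [Semiring A] [Algebra ℂ A] {ι : Type*} (X : Matrix ι ι ℂ) :
    Matrix ι ι A :=
  X.map (algebraMap ℂ A)

/-- The braid relation `R₁R₂R₁ = R₂R₁R₂` on `V^{⊗3}`. -/
def IsBraid (N : ℕ) (R : Matrix (Fin N × Fin N) (Fin N × Fin N) ℂ) : Prop :=
  opAt N 3 R 0 * opAt N 3 R 1 * opAt N 3 R 0 = opAt N 3 R 1 * opAt N 3 R 0 * opAt N 3 R 1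

/-- The Hecke condition `(q·I − R)(q⁻¹·I + R) = 0`. -/
def IsHecke (N : ℕ) (q : ℂ) (R : Matrix (Fin N × Fin N) (Fin N × Fin N) ℂ) : Prop :=
  (q • (1 : Matrix (Fin N × Fin N) (Fin N × Fin N) ℂ) - R) * (q⁻¹ • 1 + R) = 0

/-- `q` is generic: `q ∉ {0, 1, −1}` and `qⁿ ≠ 1` for all positive integers `n`. -/
def GenericQ (q : ℂ) : Prop :=
  q ≠ 0 ∧ q ≠ 1 ∧ q ≠ -1 ∧ ∀ n : ℕ, 0 < n → q ^ n ≠ 1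

/-- The reflection-equation type relation `R X₁ R X₁ = X₁ R X₁ R` in `Mat_{N²}`. -/
def RErel {α : Type*} [Semiring α] (N : ℕ)
    (R : Matrix (Fin N × Fin N) (Fin N × Fin N) α) (X : Matrix (Fin N) (Fin N) α) : Prop :=
  opAt N 2 R 0 * matAt N 2 X 0 * opAt N 2 R 0 * matAt N 2 X 0 =
    matAt N 2 X 0 * opAt N 2 R 0 * matAt N 2 X 0 * opAt N 2 R 0

/-- The quantum-double permutation relation `D₁ R M₁ R = R M₁ R⁻¹ D₁ + R` in `Mat_{N²}(A)`. -/
def PermRel {A : Type*} [Ring A] [Algebra ℂ A] (N : ℕ)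
    (R Rinv : Matrix (Fin N × Fin N) (Fin N × Fin N) ℂ)
    (M D : Matrix (Fin N) (Fin N) A) : Prop :=
  matAt N 2 D 0 * opAt N 2 (toA A R) 0 * matAt N 2 M 0 * opAt N 2 (toA A R) 0 =
    opAt N 2 (toA A R) 0 * matAt N 2 M 0 * opAt N 2 (toA A Rinv) 0 * matAt N 2 D 0 +
      opAt N 2 (toA A R) 0

/-- The homogeneous permutation relation `D₁ R M₁ R = R M₁ R⁻¹ D₁` in `Mat_{N²}(A)`. -/
def PermRelHom {A : Type*} [Ring A] [Algebra ℂ A] (N : ℕ)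
    (R Rinv : Matrix (Fin N × Fin N) (Fin N × Fin N) ℂ)
    (M D : Matrix (Fin N) (Fin N) A) : Prop :=
  matAt N 2 D 0 * opAt N 2 (toA A R) 0 * matAt N 2 M 0 * opAt N 2 (toA A R) 0 =
    opAt N 2 (toA A R) 0 * matAt N 2 M 0 * opAt N 2 (toA A Rinv) 0 * matAt N 2 D 0

/-- Overline copies: `ovCopy … r = X_{⟨r+1⟩}`, i.e. `X_{⟨1⟩} = X⊗I⊗⋯⊗I` and
`X_{⟨r+1⟩} = R_r X_{⟨r⟩} R_r⁻¹`. -/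
def ovCopy {α : Type*} [Semiring α] (N k : ℕ)
    (R Rinv : Matrix (Fin N × Fin N) (Fin N × Fin N) α)
    (X : Matrix (Fin N) (Fin N) α) : ℕ → Matrix (Fin k → Fin N) (Fin k → Fin N) α
  | 0 => matAt N k X 0
  | r + 1 => opAt N k R r * ovCopy N k R Rinv X r * opAt N k Rinv r

/-- Underline copies: `unCopy … r = X_{[r+1]}`, i.e. `X_{[1]} = X⊗I⊗⋯⊗I` and
`X_{[r+1]} = R_r⁻¹ X_{[r]} R_r`. -/
def unCopy {α : Type*} [Semiring α] (N k : ℕ)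
    (R Rinv : Matrix (Fin N × Fin N) (Fin N × Fin N) α)
    (X : Matrix (Fin N) (Fin N) α) : ℕ → Matrix (Fin k → Fin N) (Fin k → Fin N) α
  | 0 => matAt N k X 0
  | r + 1 => opAt N k Rinv r * unCopy N k R Rinv X r * opAt N k R r

/-- `X_{⟨1→n⟩} = X_{⟨1⟩}X_{⟨2⟩}⋯X_{⟨n⟩}`. -/
def ovProd {α : Type*} [Semiring α] (N k : ℕ)
    (R Rinv : Matrix (Fin N × Fin N) (Fin N × Fin N) α)
    (X : Matrix (Fin N) (Fin N) α) (n : ℕ) : Matrix (Fin k → Fin N) (Fin k → Fin N) α :=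
  ((List.range n).map (ovCopy N k R Rinv X)).prod

/-- `X_{⟨n→1⟩} = X_{⟨n⟩}X_{⟨n−1⟩}⋯X_{⟨1⟩}`. -/
def ovProdRev {α : Type*} [Semiring α] (N k : ℕ)
    (R Rinv : Matrix (Fin N × Fin N) (Fin N × Fin N) α)
    (X : Matrix (Fin N) (Fin N) α) (n : ℕ) : Matrix (Fin k → Fin N) (Fin k → Fin N) α :=
  ((List.range n).reverse.map (ovCopy N k R Rinv X)).prod

/-- Shifted Jucys–Murphy matrices: `JMup … R n s = J_{s+1}^{↑n}`, i.e. `J₁^{↑n} = I` and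
`J_{s+1}^{↑n} = R_{n+s} J_s^{↑n} R_{n+s}` (paper's 1-based `R_{n+s}` is `opAt … (n+s-1)`).
Applying it to `R⁻¹` produces `(J_{s+1}^{↑n})⁻¹`. -/
def JMup {α : Type*} [Semiring α] (N k : ℕ)
    (R : Matrix (Fin N × Fin N) (Fin N × Fin N) α) (n : ℕ) :
    ℕ → Matrix (Fin k → Fin N) (Fin k → Fin N) α
  | 0 => 1
  | s + 1 => opAt N k R (n + s) * JMup N k R n s * opAt N k R (n + s)

/-- The quantum trace `Tr_{R(1…n)}(X) = Tr(C₁C₂⋯C_n X)`. -/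
def qTr {α : Type*} [Semiring α] (N n : ℕ) (C : Matrix (Fin N) (Fin N) α)
    (X : Matrix (Fin n → Fin N) (Fin n → Fin N) α) : α :=
  Matrix.trace (((List.range n).map (matAt N n C)).prod * X)

/-- The matrix `C`, `C_i^j = Σ_k Ψ_{ik}^{jk}`. -/
def traceMat (N : ℕ) (Ψ : Matrix (Fin N × Fin N) (Fin N × Fin N) ℂ) :
    Matrix (Fin N) (Fin N) ℂ :=
  Matrix.of fun i j => ∑ k, Ψ (i, k) (j, k)

/-- Skew-invertibility of `R`: `Tr₂(R₁₂Ψ₂₃) = Tr₂(Ψ₁₂R₂₃) = P₁₃`, written componentwise. -/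
def SkewInv (N : ℕ) (R Ψ : Matrix (Fin N × Fin N) (Fin N × Fin N) ℂ) : Prop :=
  (∀ i k l n : Fin N, ∑ j, ∑ b, R (i, j) (l, b) * Ψ (b, k) (j, n) =
      if i = n ∧ k = l then 1 else 0) ∧
  (∀ i k l n : Fin N, ∑ j, ∑ b, Ψ (i, j) (l, b) * R (b, k) (j, n) =
      if i = n ∧ k = l then 1 else 0)

/-- The generators `R₁, …, R_{n−1}` (1-based) of the Hecke-algebra image inside
`End(V^{⊗k})`, as a subset of `Mat_{N^k}`. -/
def genSet {α : Type*} [Semiring α] (N k n : ℕ)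
    (R : Matrix (Fin N × Fin N) (Fin N × Fin N) α) :
    Set (Matrix (Fin k → Fin N) (Fin k → Fin N) α) :=
  {X | ∃ i : ℕ, i + 1 < n ∧ X = opAt N k R i}

/-- The left ideal of `A` generated by the entries of `D`. -/
def entryIdeal (A : Type*) [Ring A] {N : ℕ} (D : Matrix (Fin N) (Fin N) A) :
    Submodule A A :=
  Submodule.span A {x : A | ∃ i j : Fin N, x = D i j}

/-- The normally ordered monomial `:L̂_{⟨1→k⟩}: = M_{⟨1→k⟩} D_{⟨k→1⟩} ∏_{s=1}^{k} J_s⁻¹`. -/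
def normOrd {α : Type*} [Semiring α] (N k : ℕ)
    (R Rinv : Matrix (Fin N × Fin N) (Fin N × Fin N) α)
    (M D : Matrix (Fin N) (Fin N) α) (n : ℕ) :
    Matrix (Fin k → Fin N) (Fin k → Fin N) α :=
  ovProd N k R Rinv M n * ovProdRev N k R Rinv D n *
    ((List.range n).map (fun s => JMup N k Rinv 0 s)).prod

/-- On two sites, `opAt` is the reindexing along `(Fin 2 → Fin N) ≃ Fin N × Fin N`. -/
theorem opAt_two_zero {α : Type*} [Semiring α] (N : ℕ)
    (R : Matrix (Fin N × Fin N) (Fin N × Fin N) α) :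
    opAt N 2 R 0 = R.submatrix (finTwoArrowEquiv (Fin N)) (finTwoArrowEquiv (Fin N)) := by
  ext a b
  simp [opAt, Fin.forall_fin_two]

/-- On two sites, `matAt` at the first site is a reindexed block-diagonal matrix. -/
theorem matAt_two_zero {α : Type*} [Semiring α] (N : ℕ) (X : Matrix (Fin N) (Fin N) α) :
    matAt N 2 X 0 = (Matrix.blockDiagonal fun _ : Fin N => X).submatrix
      (finTwoArrowEquiv (Fin N)) (finTwoArrowEquiv (Fin N)) := by
  ext a b
  simp [matAt, Fin.forall_fin_two, Matrix.blockDiagonal_apply]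

theorem opAt_two_zero_mul {α : Type*} [Semiring α] (N : ℕ)
    (R S : Matrix (Fin N × Fin N) (Fin N × Fin N) α) :
    opAt N 2 (R * S) 0 = opAt N 2 R 0 * opAt N 2 S 0 := by
  simp only [opAt_two_zero, Matrix.submatrix_mul_equiv]

theorem opAt_two_zero_one {α : Type*} [Semiring α] (N : ℕ) :
    opAt N 2 (1 : Matrix (Fin N × Fin N) (Fin N × Fin N) α) 0 = 1 := by
  rw [opAt_two_zero, Matrix.submatrix_one_equiv]

theorem toA_mul {A : Type*} [Ring A] [Algebra ℂ A] {ι : Type*} [Fintype ι]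
    (X Y : Matrix ι ι ℂ) : toA A (X * Y) = toA A X * toA A Y :=
  Matrix.map_mul

theorem toA_one {A : Type*} [Ring A] [Algebra ℂ A] {ι : Type*} [DecidableEq ι] :
    toA A (1 : Matrix ι ι ℂ) = 1 :=
  Matrix.map_one _ (map_zero _) (map_one _)

theorem opAt_toA_add_smul {A : Type*} [Ring A] [Algebra ℂ A] (N : ℕ) (c : ℂ)
    (X Y : Matrix (Fin N × Fin N) (Fin N × Fin N) ℂ) :
    opAt N 2 (toA A (X + c • Y)) 0 = opAt N 2 (toA A X) 0 + c • opAt N 2 (toA A Y) 0 := by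
  ext a b
  simp [opAt_two_zero, toA, Algebra.smul_def c (algebraMap ℂ A _)]

theorem matAt_two_zero_one_sub_smul_mul {A : Type*} [Ring A] [Algebra ℂ A] (N : ℕ) (c : ℂ)
    (M D : Matrix (Fin N) (Fin N) A) :
    matAt N 2 (1 - c • (M * D)) 0 = 1 - c • (matAt N 2 M 0 * matAt N 2 D 0) := by
  have h : (Matrix.blockDiagonal fun _ : Fin N => 1 - c • (M * D)) =
      1 - c • ((Matrix.blockDiagonal fun _ : Fin N => M) *
        Matrix.blockDiagonal fun _ : Fin N => D) := by
    rw [← Matrix.blockDiagonal_mul, ← Matrix.blockDiagonal_smul, ← Matrix.blockDiagonal_one,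
      ← Matrix.blockDiagonal_sub]
    rfl
  simp only [matAt_two_zero, Matrix.submatrix_mul_equiv, h, Matrix.submatrix_sub,
    Matrix.submatrix_smul, Matrix.submatrix_one_equiv, Pi.sub_apply, Pi.smul_apply]

/-- The Hecke condition in quadratic form `R² = 1 + (q − q⁻¹)R`. -/
theorem IsHecke.mul_self {N : ℕ} {q : ℂ} (hq : q ≠ 0)
    {R : Matrix (Fin N × Fin N) (Fin N × Fin N) ℂ} (h : IsHecke N q R) :
    R * R = 1 + (q - q⁻¹) • R := by
  have h' : (1 : Matrix (Fin N × Fin N) (Fin N × Fin N) ℂ) + (q - q⁻¹) • R - R * R = 0 := by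
    rw [← h, sub_mul, mul_add, mul_add]
    simp only [smul_mul_assoc, mul_smul_comm, one_mul, mul_one, smul_smul,
      inv_mul_cancel₀ hq, one_smul, sub_smul]
    abel
  exact (sub_eq_zero.mp h').symm

/-- The inhomogeneous reflection equation for the product of generators of a quantum double. -/
theorem reflection_mul_of_quantumDouble {B : Type*} [Ring B] {r s m d : B}
    (hrs : r * s = 1) (hsr : s * r = 1)
    (hm : r * m * r * m = m * r * m * r) (hd : s * d * s * d = d * s * d * s)
    (hdm : d * r * m * r = r * m * s * d + r) :
    r * (m * d) * r * (m * d) - r * (m * d) =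
      (m * d) * r * (m * d) * r - (m * d) * r := by
  have hdrm : d * r * m = r * m * s * d * s + 1 := by
    calc d * r * m = d * r * m * r * s := by rw [mul_assoc _ r s, hrs, mul_one]
      _ = r * m * s * d * s + 1 := by rw [hdm, add_mul, hrs]
  have hl : r * (m * d) * r * (m * d) - r * (m * d) = m * r * m * d * s * d := by
    calc r * (m * d) * r * (m * d) - r * (m * d)
        = r * m * (d * r * m) * d - r * (m * d) := by simp only [mul_assoc]
      _ = r * m * r * m * (s * d * s * d) := by rw [hdrm]; noncomm_ring
      _ = m * r * m * (r * s) * d * s * d := by rw [hm]; simp only [mul_assoc]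
      _ = m * r * m * d * s * d := by rw [hrs, mul_one]
  have hr : (m * d) * r * (m * d) * r - (m * d) * r = m * r * m * d * s * d := by
    calc (m * d) * r * (m * d) * r - (m * d) * r
        = m * (d * r * m) * d * r - m * d * r := by simp only [mul_assoc]
      _ = m * r * m * (s * d * s * d) * r := by rw [hdrm]; noncomm_ring
      _ = m * r * m * d * s * d * (s * r) := by rw [hd]; simp only [mul_assoc]
      _ = m * r * m * d * s * d := by rw [hsr, mul_one]
  rw [hl, hr]

/-- For a Hecke-type `r`, the affine shift `1 - c • l` turns the inhomogeneous reflection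
equation into the homogeneous one. -/
theorem reflection_one_sub_smul {B : Type*} [Ring B] [Algebra ℂ B] {r l : B} {c : ℂ}
    (hr : r * r = 1 + c • r) (hl : r * l * r * l - r * l = l * r * l * r - l * r) :
    r * (1 - c • l) * r * (1 - c • l) = (1 - c • l) * r * (1 - c • l) * r := by
  have hleft : r * (1 - c • l) * r * (1 - c • l) =
      r * r - c • (r * l * r) - c • l + (c * c) • (r * l * r * l - r * l) := by
    have h : r * (1 - c • l) * r * (1 - c • l) =
        r * r - c • (r * l * r) - c • (r * r * l) + (c * c) • (r * l * r * l) := by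
      simp only [mul_sub, sub_mul, mul_one, mul_smul_comm, smul_mul_assoc, smul_sub, mul_smul]
      abel
    rw [h, hr, add_mul, one_mul, smul_mul_assoc, smul_add, smul_smul, smul_sub]
    abel
  have hright : (1 - c • l) * r * (1 - c • l) * r =
      r * r - c • (r * l * r) - c • l + (c * c) • (l * r * l * r - l * r) := by
    have h : (1 - c • l) * r * (1 - c • l) * r =
        r * r - c • (r * l * r) - c • (l * (r * r)) + (c * c) • (l * r * l * r) := by
      simp only [mul_sub, sub_mul, one_mul, mul_one, mul_smul_comm, smul_mul_assoc, smul_sub,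
        mul_smul, mul_assoc]
      abel
    rw [h, hr, mul_add, mul_one, mul_smul_comm, smul_add, smul_smul, smul_sub]
    abel
  rw [hleft, hright, hl]

/-- `K̂ = I − (q − q⁻¹)·MD` satisfies the homogeneous
reflection-equation relation `R K̂₁ R K̂₁ = K̂₁ R K̂₁ R` in `Mat_{N²}(A)`. -/
theorem stmt2 {A : Type*} [Ring A] [Algebra ℂ A] (N : ℕ) (hN : 1 ≤ N) (q : ℂ)
    (hq : GenericQ q)
    (R Rinv : Matrix (Fin N × Fin N) (Fin N × Fin N) ℂ)
    (hRinv : R * Rinv = 1 ∧ Rinv * R = 1)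
    (hbraid : IsBraid N R) (hHecke : IsHecke N q R)
    (M D : Matrix (Fin N) (Fin N) A)
    (hM : RErel N (toA A R) M)
    (hD : RErel N (toA A Rinv) D)
    (hDM : PermRel N R Rinv M D) :
    RErel N (toA A R) ((1 : Matrix (Fin N) (Fin N) A) - (q - q⁻¹) • (M * D)) := by
  have hrs : opAt N 2 (toA A R) 0 * opAt N 2 (toA A Rinv) 0 = 1 := by
    rw [← opAt_two_zero_mul, ← toA_mul, hRinv.1, toA_one, opAt_two_zero_one]
  have hsr : opAt N 2 (toA A Rinv) 0 * opAt N 2 (toA A R) 0 = 1 := by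
    rw [← opAt_two_zero_mul, ← toA_mul, hRinv.2, toA_one, opAt_two_zero_one]
  have hrr : opAt N 2 (toA A R) 0 * opAt N 2 (toA A R) 0 =
      1 + (q - q⁻¹) • opAt N 2 (toA A R) 0 := by
    rw [← opAt_two_zero_mul, ← toA_mul, hHecke.mul_self hq.1, opAt_toA_add_smul, toA_one,
      opAt_two_zero_one]
  rw [RErel, matAt_two_zero_one_sub_smul_mul]
  exact reflection_one_sub_smul hrr (reflection_mul_of_quantumDouble hrs hsr hM hD hDM)
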